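/- Let Γ be a finite connected multigraph whose first Betti number b₁(Γ) = |Edges(Γ)| − |Verts(Γ)| + 1 equals 1. Then for every degree-d stability assignment σ for Γ there exists a nondegenerate φ ∈ V^d(Γ) such that σ = stab_{Γ,φ}. -/

import Mathlib

open Finset

variable {V E : Type} [Fintype V] [Fintype E] [DecidableEq V] [DecidableEq E]

/-- The unordered pair of endpoints of an edge. -/
def eSym (ends : E → V × V) (e : E) : Sym2 V := s((ends e).1, (ends e).2)

/-- Reachability in the spanning subgraph with edge set `A`. -/
def Linked (ends : E → V × V) (A : Finset E) : V → V → Prop :=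
  Relation.ReflTransGen (fun v w => ∃ e ∈ A, eSym ends e = s(v, w))

/-- The spanning subgraph with edge set `A` is connected. -/
def Conn (ends : E → V × V) (A : Finset E) : Prop :=
  Nonempty V ∧ ∀ v w : V, Linked ends A v w

/-- The induced subgraph on the vertex set `W` is connected. -/
def ConnOn (ends : E → V × V) (W : Finset V) : Prop :=
  W.Nonempty ∧ ∀ v ∈ W, ∀ w ∈ W,
    Relation.ReflTransGen (fun a b => a ∈ W ∧ b ∈ W ∧ ∃ e : E, eSym ends e = s(a, b)) v w

/-- A spanning tree: a connected spanning subgraph with `|V| - 1` edges. -/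
def IsSpanningTree (ends : E → V × V) (A : Finset E) : Prop :=
  Conn ends A ∧ A.card + 1 = Fintype.card V

/-- The complexity of the spanning subgraph `A`: the number of its spanning trees. -/
noncomputable def complexity (ends : E → V × V) (A : Finset E) : ℕ :=
  Nat.card {T : Finset E // T ⊆ A ∧ IsSpanningTree ends T}

/-- `n(G)`: the number of edges of `Γ` missing from the spanning subgraph `G`. -/
def nG (A : Finset E) : ℕ := (Finset.univ \ A).card

/-- The space of multidegrees of total degree `d` at `A`. -/
def Sdeg (d : ℤ) (A : Finset E) : Set (V → ℤ) :=
  {x | ∑ v, x v = d - (nG A : ℤ)}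

/-- The twister at vertex `v` of the spanning subgraph with edge set `A`. -/
def twVec (ends : E → V × V) (A : Finset E) (v : V) : V → ℤ := fun w =>
  if w = v then
    -((A.filter (fun e => v ∈ eSym ends e ∧ ¬(eSym ends e).IsDiag)).card : ℤ)
  else ((A.filter (fun e => eSym ends e = s(v, w))).card : ℤ)

/-- The twister (chip-firing) group of the spanning subgraph with edge set `A`. -/
def twGroup (ends : E → V × V) (A : Finset E) : AddSubgroup (V → ℤ) :=
  AddSubgroup.closure (Set.range (twVec ends A))

/-- The standard basis vector at `v`. -/
def stdVec (v : V) : V → ℤ := fun w => if w = v then 1 else 0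

/-- A degree-`d` assignment: supported on connected spanning subgraphs, with the
prescribed total degree. -/
def IsAssignment (ends : E → V × V) (d : ℤ) (σ : Finset E → Set (V → ℤ)) : Prop :=
  ∀ A : Finset E, ∀ x ∈ σ A, Conn ends A ∧ x ∈ Sdeg d A

/-- Condition (1), chip-adding. -/
def ChipAdding (ends : E → V × V) (σ : Finset E → Set (V → ℤ)) : Prop :=
  ∀ A : Finset E, ∀ x ∈ σ A, ∀ e ∉ A, ∀ v ∈ eSym ends e, x + stdVec v ∈ σ (insert e A)

/-- `S` is a minimal complete set of representatives for the action of the twister group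
of `A` on the multidegree space `S^d(A)`. -/
def IsRepSet (ends : E → V × V) (d : ℤ) (A : Finset E) (S : Set (V → ℤ)) : Prop :=
  S ⊆ Sdeg d A ∧ ∀ x ∈ Sdeg (E := E) d A, ∃! y, y ∈ S ∧ x - y ∈ twGroup ends A

/-- A degree-`d` stability assignment. -/
def IsStabilityAssignment (ends : E → V × V) (d : ℤ) (σ : Finset E → Set (V → ℤ)) : Prop :=
  IsAssignment ends d σ ∧ ChipAdding ends σ ∧
    ∀ A : Finset E, Conn ends A → IsRepSet ends d A (σ A)

/-- Vertices of the subdivision `Γ̃_m`: original vertices plus, for each edge `e`,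
`m e` exceptional vertices. -/
abbrev SubV (V E : Type) (m : E → ℕ) : Type := V ⊕ (Σ e : E, Fin (m e))

/-- Edges of the subdivision `Γ̃_m`: each edge `e` is replaced by a chain of `m e + 1` edges. -/
abbrev SubE (E : Type) (m : E → ℕ) : Type := Σ e : E, Fin (m e + 1)

/-- The `i`-th vertex along the chain replacing the edge `e` in the subdivision. -/
def subNode (ends : E → V × V) (m : E → ℕ) (e : E) (i : ℕ) : SubV V E m :=
  if h0 : i = 0 then Sum.inl (ends e).1
  else if h : i ≤ m e then Sum.inr ⟨e, ⟨i - 1, by omega⟩⟩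
  else Sum.inl (ends e).2

/-- The endpoints of the edges of the subdivision `Γ̃_m`. -/
def subEnds (ends : E → V × V) (m : E → ℕ) : SubE E m → SubV V E m × SubV V E m :=
  fun p => (subNode ends m p.1 p.2.val, subNode ends m p.1 (p.2.val + 1))

/-- The lift of the multidegree `x` on `(A, Γ)`: extend by zero and add one chip on
the exceptional vertex `t e` of every removed edge `e ∉ A`. -/
def liftOf (m : E → ℕ) (A : Finset E) (x : V → ℤ) (t : E → ℕ) : SubV V E m → ℤ :=
  Sum.elim x fun p => if p.1 ∉ A ∧ (p.2 : ℕ) = t p.1 then 1 else 0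

/-- The lift `σ̃_m` of an assignment `σ`: all lifts of all elements of `σ`. -/
def liftSet (m : E → ℕ) (σ : Finset E → Set (V → ℤ)) : Set (SubV V E m → ℤ) :=
  {y | ∃ (A : Finset E) (x : V → ℤ) (t : E → ℕ),
    x ∈ σ A ∧ (∀ e ∉ A, t e < m e) ∧ y = liftOf m A x t}

/-- Edges with both endpoints in `W` (the edges of the induced subgraph `Γ(W)`). -/
def inE (ends : E → V × V) (W : Finset V) : Finset E :=
  Finset.univ.filter fun e => (ends e).1 ∈ W ∧ (ends e).2 ∈ W

/-- Edges with one endpoint in `W` and the other in `Wᶜ`. -/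
def cutE (ends : E → V × V) (W : Finset V) : Finset E :=
  Finset.univ.filter fun e =>
    ((ends e).1 ∈ W ∧ (ends e).2 ∉ W) ∨ ((ends e).1 ∉ W ∧ (ends e).2 ∈ W)

/-- `φ`-semistability of the multidegree `x` on the spanning subgraph `A`. -/
def PhiSemistable (ends : E → V × V) (φ : V → ℝ) (A : Finset E) (x : V → ℤ) : Prop :=
  ∀ W : Finset V, W.Nonempty → W ≠ Finset.univ →
    |(∑ v ∈ W, ((x v : ℝ) - φ v)) + (((Finset.univ \ A) ∩ inE ends W).card : ℝ) +
        (((Finset.univ \ A) ∩ cutE ends W).card : ℝ) / 2| ≤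
      ((A ∩ cutE ends W).card : ℝ) / 2

/-- `φ`-stability of the multidegree `x` on the spanning subgraph `A`. -/
def PhiStable (ends : E → V × V) (φ : V → ℝ) (A : Finset E) (x : V → ℤ) : Prop :=
  ∀ W : Finset V, W.Nonempty → W ≠ Finset.univ →
    |(∑ v ∈ W, ((x v : ℝ) - φ v)) + (((Finset.univ \ A) ∩ inE ends W).card : ℝ) +
        (((Finset.univ \ A) ∩ cutE ends W).card : ℝ) / 2| <
      ((A ∩ cutE ends W).card : ℝ) / 2

/-- Nondegeneracy of a numerical polarization `φ`. -/
def Nondegenerate (ends : E → V × V) (d : ℤ) (φ : V → ℝ) : Prop :=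
  ∀ A : Finset E, ∀ x ∈ Sdeg d A, PhiSemistable ends φ A x → PhiStable ends φ A x

/-- The assignment `stab_{Γ,φ}` associated with a numerical polarization `φ`. -/
def stabAssign (ends : E → V × V) (d : ℤ) (φ : V → ℝ) : Finset E → Set (V → ℤ) :=
  fun A => {x | Conn ends A ∧ x ∈ Sdeg d A ∧ PhiSemistable ends φ A x}

/-- The valence of the vertex `v` (loops counted twice). -/
def valence (ends : E → V × V) (v : V) : ℕ :=
  ∑ e : E, ((if (ends e).1 = v then 1 else 0) + (if (ends e).2 = v then 1 else 0))

/-- `x` is an integral break divisor for the connected spanning subgraph `A`. -/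
def isIBD (ends : E → V × V) (gen : V → ℕ) (A : Finset E) (x : V → ℤ) : Prop :=
  ∃ T : Finset E, T ⊆ A ∧ IsSpanningTree ends T ∧
    ∃ t : E → V, (∀ e ∈ A \ T, t e ∈ eSym ends e) ∧
      x = fun v => (gen v : ℤ) + (((A \ T).filter fun e => t e = v).card : ℤ)

/-- The multidegree `(a, b)` on a two-vertex graph with first vertex `v₁`. -/
def pairFn (v₁ : V) (a b : ℤ) : V → ℤ := fun w => if w = v₁ then a else b

set_option linter.unusedSectionVars false

/-! ### Integral flows -/

/-- The boundary of an integral flow on the edges, each edge being directed from its first to its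
second endpoint. -/
def bdry (ends : E → V × V) : (E → ℤ) →ₗ[ℤ] (V → ℤ) where
  toFun f := ∑ e, f e • (stdVec (ends e).2 - stdVec (ends e).1)
  map_add' f g := by simp only [Pi.add_apply, add_smul, sum_add_distrib]
  map_smul' c f := by
    simp only [Pi.smul_apply, smul_eq_mul, mul_smul, smul_sum, RingHom.id_apply]

theorem bdry_def (ends : E → V × V) (f : E → ℤ) :
    bdry ends f = ∑ e, f e • (stdVec (ends e).2 - stdVec (ends e).1) := rfl

theorem bdry_single (ends : E → V × V) (e : E) (c : ℤ) :
    bdry ends (Pi.single e c) = c • (stdVec (ends e).2 - stdVec (ends e).1) := by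
  rw [bdry_def, Fintype.sum_eq_single e]
  · simp
  · intro x hx
    simp [hx]

/-- The signed incidence of the edge `e` with the cut defined by `W`. -/
def cutSign (ends : E → V × V) (W : Finset V) (e : E) : ℤ :=
  (if (ends e).2 ∈ W then 1 else 0) - (if (ends e).1 ∈ W then 1 else 0)

theorem sum_stdVec (W : Finset V) (v : V) : ∑ w ∈ W, stdVec v w = if v ∈ W then 1 else 0 := by
  simp [stdVec]

theorem sum_bdry (ends : E → V × V) (W : Finset V) (f : E → ℤ) :
    ∑ v ∈ W, bdry ends f v = ∑ e, f e * cutSign ends W e := by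
  simp only [bdry_def, Finset.sum_apply, Pi.smul_apply, Pi.sub_apply, smul_eq_mul]
  rw [sum_comm]
  refine sum_congr rfl fun e _ => ?_
  rw [← mul_sum, sum_sub_distrib, sum_stdVec, sum_stdVec, cutSign]

theorem sum_univ_bdry (ends : E → V × V) (f : E → ℤ) : ∑ v, bdry ends f v = 0 := by
  simp [sum_bdry, cutSign]

theorem abs_cutSign (ends : E → V × V) (W : Finset V) (e : E) :
    |cutSign ends W e| = if e ∈ cutE ends W then 1 else 0 := by
  by_cases h1 : (ends e).1 ∈ W <;> by_cases h2 : (ends e).2 ∈ W <;> simp [cutSign, cutE, h1, h2]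

theorem sum_abs_cutSign (ends : E → V × V) (W : Finset V) :
    ∑ e, |cutSign ends W e| = ((cutE ends W).card : ℤ) := by
  simp [abs_cutSign]

theorem exists_flow_of_linked (ends : E → V × V) (A : Finset E) {v w : V}
    (h : Linked ends A v w) :
    ∃ f : E → ℤ, (∀ e ∉ A, f e = 0) ∧ bdry ends f = stdVec w - stdVec v := by
  induction h with
  | refl => exact ⟨0, fun _ _ => rfl, by simp⟩
  | tail _ hbc ih =>
    obtain ⟨f, hf, hb⟩ := ih
    obtain ⟨e, he, hs⟩ := hbc
    rw [eSym, Sym2.eq_iff] at hs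
    have key : ∀ c : ℤ, ∀ e' ∉ A, (f + Pi.single e c : E → ℤ) e' = 0 := fun c e' he' => by
      have : e' ≠ e := fun h => he' (h ▸ he)
      simp [hf e' he', this]
    rcases hs with ⟨h1, h2⟩ | ⟨h1, h2⟩
    · refine ⟨f + Pi.single e 1, key 1, ?_⟩
      rw [map_add, hb, bdry_single, h1, h2]
      simp
    · refine ⟨f + Pi.single e (-1), key (-1), ?_⟩
      rw [map_add, hb, bdry_single, h1, h2]
      simp

theorem exists_bdry_eq (ends : E → V × V) (hconn : Conn ends univ) (D : V → ℤ)
    (hD : ∑ v, D v = 0) : ∃ f : E → ℤ, bdry ends f = D := by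
  obtain ⟨⟨r⟩, hl⟩ := hconn
  choose p _ hp using fun v => exists_flow_of_linked ends univ (hl r v)
  refine ⟨∑ v, D v • p v, ?_⟩
  rw [map_sum]
  simp only [map_smul, hp, smul_sub, sum_sub_distrib]
  rw [← sum_smul, hD, zero_smul, sub_zero]
  ext w
  simp [stdVec]

/-- On a connected multigraph of first Betti number one, the integral cycles are the multiples of
a single nonzero cycle. -/
theorem exists_cycle_generator (ends : E → V × V) (hconn : Conn ends univ)
    (hb1 : Fintype.card E = Fintype.card V) :
    ∃ h : E → ℤ, bdry ends h = 0 ∧ h ≠ 0 ∧ ∀ g, bdry ends g = 0 → ∃ m : ℤ, g = m • h := by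
  let S : (V → ℤ) →ₗ[ℤ] ℤ := ∑ v, LinearMap.proj v
  have hS : ∀ x, S x = ∑ v, x v := fun x => by simp [S]
  have hsurj : Function.Surjective S := fun c => by
    obtain ⟨⟨r⟩, -⟩ := hconn
    exact ⟨c • stdVec r, by simp [hS, ← mul_sum, sum_stdVec]⟩
  have hrange : LinearMap.range (bdry ends) = LinearMap.ker S := by
    ext x
    rw [LinearMap.mem_range, LinearMap.mem_ker, hS]
    exact ⟨fun ⟨f, hf⟩ => hf ▸ sum_univ_bdry ends f, exists_bdry_eq ends hconn x⟩
  have h1 := (LinearMap.ker S).finrank_quotient_add_finrank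
  have h2 := (LinearMap.ker (bdry ends)).finrank_quotient_add_finrank
  rw [(S.quotKerEquivOfSurjective hsurj).finrank_eq, Module.finrank_self, Module.finrank_pi] at h1
  rw [(bdry ends).quotKerEquivRange.finrank_eq, hrange, Module.finrank_pi] at h2
  have h3 : Module.finrank ℤ (LinearMap.ker (bdry ends)) = 1 := by omega
  obtain ⟨⟨h, hh⟩, hne, hgen⟩ := finrank_eq_one_iff'.1 h3
  refine ⟨h, hh, fun h0 => hne (Subtype.ext h0), fun g hg => ?_⟩
  obtain ⟨c, hc⟩ := hgen ⟨g, hg⟩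
  exact ⟨c, (congrArg Subtype.val hc).symm⟩

/-! ### Cuts -/

theorem exists_mem_cutE_of_linked (ends : E → V × V) (A : Finset E) (W : Finset V) {v w : V}
    (h : Linked ends A v w) (hv : v ∈ W) (hw : w ∉ W) : ∃ e ∈ A, e ∈ cutE ends W := by
  induction h with
  | refl => exact absurd hv hw
  | @tail b c _ hbc ih =>
    by_cases hb : b ∈ W
    · obtain ⟨e, he, hs⟩ := hbc
      rw [eSym, Sym2.eq_iff] at hs
      refine ⟨e, he, ?_⟩
      rw [cutE, mem_filter]
      rcases hs with ⟨h1, h2⟩ | ⟨h1, h2⟩ <;> simp [h1, h2, hb, hw]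
    · exact ih hb

theorem cutE_inter_nonempty (ends : E → V × V) {A : Finset E} (hA : Conn ends A) {W : Finset V}
    (hW : W.Nonempty) (hW' : W ≠ univ) : (A ∩ cutE ends W).Nonempty := by
  obtain ⟨v, hv⟩ := hW
  obtain ⟨w, hw⟩ : ∃ w, w ∉ W := by
    by_contra! h
    exact hW' (eq_univ_iff_forall.2 h)
  obtain ⟨e, he, hc⟩ := exists_mem_cutE_of_linked ends A W (hA.2 v w) hv hw
  exact ⟨e, mem_inter.2 ⟨he, hc⟩⟩

theorem exists_cut_of_not_conn (ends : E → V × V) [Nonempty V] {A : Finset E}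
    (hA : ¬ Conn ends A) :
    ∃ W : Finset V, W.Nonempty ∧ W ≠ univ ∧ A ∩ cutE ends W = ∅ := by
  classical
  obtain ⟨v, w, hvw⟩ : ∃ v w, ¬ Linked ends A v w := by
    by_contra! h
    exact hA ⟨inferInstance, h⟩
  refine ⟨univ.filter (Linked ends A v), ⟨v, mem_filter.2 ⟨mem_univ v, .refl⟩⟩,
    fun h => hvw ?_, ?_⟩
  · simpa using h.ge (mem_univ w)
  · rw [eq_empty_iff_forall_notMem]
    intro e he
    rw [mem_inter, cutE, mem_filter] at he
    simp only [mem_filter, mem_univ, true_and] at he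
    obtain ⟨heA, ⟨h1, h2⟩ | ⟨h1, h2⟩⟩ := he
    · exact h2 (h1.tail ⟨e, heA, rfl⟩)
    · exact h1 (h2.tail ⟨e, heA, by rw [eSym, Sym2.eq_swap]⟩)

/-! ### Twisters -/

/-- The coboundary of `u`, restricted to the edges in `A`. -/
def cobdryOn (ends : E → V × V) (A : Finset E) : (V → ℤ) →ₗ[ℤ] (E → ℤ) where
  toFun u e := if e ∈ A then u (ends e).2 - u (ends e).1 else 0
  map_add' u v := by
    ext e
    by_cases h : e ∈ A <;> simp [h]
    ring
  map_smul' c u := by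
    ext e
    by_cases h : e ∈ A <;> simp [h]
    ring

theorem cobdryOn_apply (ends : E → V × V) (A : Finset E) (u : V → ℤ) (e : E) :
    cobdryOn ends A u e = if e ∈ A then u (ends e).2 - u (ends e).1 else 0 := rfl

theorem twVec_eq (ends : E → V × V) (A : Finset E) (v : V) :
    twVec ends A v = bdry ends (cobdryOn ends A (-stdVec v)) := by
  ext w
  simp only [bdry_def, Finset.sum_apply, Pi.smul_apply, Pi.sub_apply, smul_eq_mul, cobdryOn_apply,
    twVec, Pi.neg_apply, ite_mul, zero_mul]
  rw [← sum_filter, filter_mem_eq_inter, univ_inter]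
  split_ifs with hw
  · subst hw
    rw [card_filter, Nat.cast_sum, ← sum_neg_distrib]
    refine sum_congr rfl fun e _ => ?_
    simp only [eSym, Sym2.mem_iff, Sym2.mk_isDiag_iff, stdVec]
    grind
  · rw [card_filter, Nat.cast_sum]
    refine sum_congr rfl fun e _ => ?_
    simp only [eSym, Sym2.eq_iff, stdVec]
    grind

theorem mem_twGroup_iff (ends : E → V × V) (A : Finset E) (x : V → ℤ) :
    x ∈ twGroup ends A ↔ ∃ u : V → ℤ, x = bdry ends (cobdryOn ends A u) := by
  constructor
  · intro hx
    induction hx using AddSubgroup.closure_induction with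
    | mem x hx =>
      obtain ⟨v, rfl⟩ := hx
      exact ⟨_, twVec_eq ends A v⟩
    | zero => exact ⟨0, by simp⟩
    | add x y _ _ hx hy =>
      obtain ⟨u, rfl⟩ := hx
      obtain ⟨v, rfl⟩ := hy
      exact ⟨u + v, by simp⟩
    | neg x _ hx =>
      obtain ⟨u, rfl⟩ := hx
      exact ⟨-u, by simp⟩
  · rintro ⟨u, rfl⟩
    have hu : u = ∑ v, (-u v) • (-stdVec v : V → ℤ) := by
      ext w
      simp [stdVec]
    rw [hu, map_sum, map_sum]
    refine sum_mem fun v _ => ?_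
    rw [map_smul, map_smul, ← twVec_eq]
    exact zsmul_mem (AddSubgroup.subset_closure (Set.mem_range_self v)) _

/-! ### Stability under adding chips and uniqueness of representatives -/

/-- The quantity whose absolute value is bounded in the definition of stability. -/
noncomputable def defect (ends : E → V × V) (φ : V → ℝ) (A : Finset E) (x : V → ℤ)
    (W : Finset V) : ℝ :=
  (∑ v ∈ W, ((x v : ℝ) - φ v)) + (((univ \ A) ∩ inE ends W).card : ℝ) +
    (((univ \ A) ∩ cutE ends W).card : ℝ) / 2

theorem card_insert_inter {e : E} {A : Finset E} (he : e ∉ A) (X : Finset E) :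
    (insert e A ∩ X).card = (A ∩ X).card + if e ∈ X then 1 else 0 := by
  split_ifs with h
  · rw [insert_inter_of_mem h, card_insert_of_notMem (by simp [he])]
  · rw [insert_inter_of_notMem h, add_zero]

theorem card_sdiff_inter {e : E} {A : Finset E} (he : e ∉ A) (X : Finset E) :
    ((univ \ A) ∩ X).card = ((univ \ insert e A) ∩ X).card + if e ∈ X then 1 else 0 := by
  rw [← card_insert_inter (by simp)]
  congr 2
  ext e'
  simp only [mem_sdiff, mem_univ, true_and, mem_insert]
  grind

theorem ite_mem_cutE (ends : E → V × V) {e : E} {v v' : V} (hs : eSym ends e = s(v, v'))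
    (W : Finset V) : (if e ∈ cutE ends W then (1 : ℝ) else 0) =
      |(if v ∈ W then (1 : ℝ) else 0) - if v' ∈ W then 1 else 0| := by
  rw [eSym, Sym2.eq_iff] at hs
  rcases hs with ⟨h1, h2⟩ | ⟨h1, h2⟩ <;> simp only [cutE, mem_filter, h1, h2] <;>
    by_cases hv : v ∈ W <;> by_cases hv' : v' ∈ W <;> simp [hv, hv']

theorem ite_mem_inE (ends : E → V × V) {e : E} {v v' : V} (hs : eSym ends e = s(v, v'))
    (W : Finset V) : (if e ∈ inE ends W then (1 : ℝ) else 0) =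
      (if v ∈ W then (1 : ℝ) else 0) * if v' ∈ W then 1 else 0 := by
  rw [eSym, Sym2.eq_iff] at hs
  rcases hs with ⟨h1, h2⟩ | ⟨h1, h2⟩ <;> simp only [inE, mem_filter, h1, h2] <;>
    by_cases hv : v ∈ W <;> by_cases hv' : v' ∈ W <;> simp [hv, hv']

theorem defect_insert (ends : E → V × V) (φ : V → ℝ) {A : Finset E} (x : V → ℤ) (W : Finset V)
    {e : E} (he : e ∉ A) {v v' : V} (hs : eSym ends e = s(v, v')) :
    defect ends φ (insert e A) (x + stdVec v) W =
      defect ends φ A x W + ((if v ∈ W then 1 else 0) - if v' ∈ W then 1 else 0) / 2 := by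
  have h1 : ∑ w ∈ W, (((x + stdVec v) w : ℤ) - φ w) =
      ∑ w ∈ W, ((x w : ℝ) - φ w) + if v ∈ W then 1 else 0 := by
    have := congrArg (Int.cast : ℤ → ℝ) (sum_stdVec W v)
    push_cast at this
    rw [← this, ← sum_add_distrib]
    refine sum_congr rfl fun w _ => ?_
    rw [Pi.add_apply]
    push_cast
    ring
  rw [defect, defect, h1, card_sdiff_inter he, card_sdiff_inter he]
  push_cast
  rw [ite_mem_cutE ends hs, ite_mem_inE ends hs]
  by_cases hv : v ∈ W <;> by_cases hv' : v' ∈ W <;> simp [hv, hv'] <;> ring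

theorem PhiSemistable.insert {ends : E → V × V} {φ : V → ℝ} {A : Finset E} {x : V → ℤ}
    (hx : PhiSemistable ends φ A x) {e : E} (he : e ∉ A) {v v' : V}
    (hs : eSym ends e = s(v, v')) : PhiSemistable ends φ (insert e A) (x + stdVec v) := by
  intro W hW hW'
  have h := hx W hW hW'
  rw [← defect] at h ⊢
  rw [defect_insert ends φ x W he hs, card_insert_inter he]
  push_cast
  rw [ite_mem_cutE ends hs, add_div]
  refine (abs_add_le _ _).trans (add_le_add h ?_)
  rw [abs_div, abs_two]

theorem eq_of_semistable_of_stable {ends : E → V × V} {φ : V → ℝ} {A : Finset E} {x y : V → ℤ}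
    (hx : PhiSemistable ends φ A x) (hy : PhiStable ends φ A y) (hxy : x - y ∈ twGroup ends A) :
    x = y := by
  obtain ⟨u, hu⟩ := (mem_twGroup_iff ends A _).1 hxy
  by_cases hV : Nonempty V
  swap
  · exact funext fun v => (hV ⟨v⟩).elim
  obtain ⟨m, hm⟩ := Finite.exists_max u
  by_cases hconst : ∀ v, u v = u m
  · rw [← sub_eq_zero, hu]
    have : cobdryOn ends A u = 0 := by
      ext e
      rw [cobdryOn_apply, hconst, hconst (ends e).1]
      simp
    rw [this, map_zero]
  exfalso
  push Not at hconst
  obtain ⟨w, hw⟩ := hconst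
  have hW : (univ.filter fun v => u v = u m).Nonempty := ⟨m, by simp⟩
  have hW' : (univ.filter fun v => u v = u m) ≠ univ := fun h =>
    hw (by simpa using h.ge (mem_univ w))
  have hmem : ∀ v, v ∈ (univ.filter fun v => u v = u m) ↔ u v = u m := by simp
  generalize (univ.filter fun v => u v = u m) = W at hW hW' hmem
  have h1 := hx W hW hW'
  have h2 := hy W hW hW'
  have h3 : ((A ∩ cutE ends W).card : ℤ) ≤ ∑ v ∈ W, (x - y) v := by
    rw [hu, sum_bdry, card_eq_sum_ones, Nat.cast_sum, ← univ_inter (A ∩ cutE ends W),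
      ← sum_ite_mem]
    refine sum_le_sum fun e _ => ?_
    have := hm (ends e).1
    have := hm (ends e).2
    have := hmem (ends e).1
    have := hmem (ends e).2
    simp only [cobdryOn_apply, mem_inter, cutE, mem_filter, mem_univ, true_and, cutSign]
    by_cases e1 : (ends e).1 ∈ W <;> by_cases e2 : (ends e).2 ∈ W <;> by_cases e3 : e ∈ A <;>
      simp [e1, e2, e3] <;> grind
  have h4 : (((A ∩ cutE ends W).card : ℤ) : ℝ) ≤ ((∑ v ∈ W, (x - y) v : ℤ) : ℝ) := by
    exact_mod_cast h3
  have h5 : ((∑ v ∈ W, (x - y) v : ℤ) : ℝ) =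
      ∑ v ∈ W, ((x v : ℝ) - φ v) - ∑ v ∈ W, ((y v : ℝ) - φ v) := by
    rw [← sum_sub_distrib]
    push_cast [Pi.sub_apply]
    exact sum_congr rfl fun v _ => by ring
  rw [h5] at h4
  push_cast at h4
  have h6 := (abs_le.1 h1).2
  have h7 := (abs_lt.1 h2).1
  linarith

theorem mem_Sdeg_insert {d : ℤ} {A : Finset E} {x : V → ℤ} (hx : x ∈ Sdeg d A) {e : E}
    (he : e ∉ A) (v : V) : x + stdVec v ∈ Sdeg d (insert e A) := by
  have h : nG A = nG (insert e A) + 1 := by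
    simpa [nG] using card_sdiff_inter he univ
  simp only [Sdeg, Set.mem_ofPred_eq, Pi.add_apply, sum_add_distrib, sum_stdVec, mem_univ,
    if_true] at hx ⊢
  rw [hx, h]
  push_cast
  ring

/-- If every semistable multidegree on a connected spanning subgraph is stable, then the
polarization is nondegenerate. -/
theorem nondegenerate_of_conn {ends : E → V × V} (hconn : Conn ends univ) {d : ℤ} {φ : V → ℝ}
    (H : ∀ A : Finset E, Conn ends A → ∀ x ∈ Sdeg d A, PhiSemistable ends φ A x →
      PhiStable ends φ A x) : Nondegenerate ends d φ := by
  intro A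
  induction hn : (univ \ A).card using Nat.strong_induction_on generalizing A with
  | _ n ih =>
  intro x hx hss
  by_cases hA : Conn ends A
  · exact H A hA x hx hss
  exfalso
  have := hconn.1
  obtain ⟨W, hW, hW', hcut⟩ := exists_cut_of_not_conn ends hA
  obtain ⟨e, he⟩ := cutE_inter_nonempty ends hconn hW hW'
  rw [univ_inter] at he
  have heA : e ∉ A := fun h => by
    have := mem_inter.2 ⟨h, he⟩
    simp [hcut] at this
  obtain ⟨v, v', hs, hv, hv'⟩ : ∃ v v', eSym ends e = s(v, v') ∧ v ∈ W ∧ v' ∉ W := by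
    obtain ⟨-, ⟨h1, h2⟩ | ⟨h1, h2⟩⟩ := mem_filter.1 he
    · exact ⟨_, _, rfl, h1, h2⟩
    · exact ⟨_, _, Sym2.eq_swap, h2, h1⟩
  have hlt : (univ \ insert e A).card < n := by
    have := card_sdiff_inter heA univ
    simp only [inter_univ, mem_univ, if_true] at this
    omega
  have hst := ih _ hlt (insert e A) rfl _ (mem_Sdeg_insert hx heA v) (hss.insert heA hs) W hW hW'
  have h0 := hss W hW hW'
  rw [← defect] at hst h0
  rw [defect_insert ends φ x W heA hs, card_insert_inter heA, hcut] at hst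
  rw [hcut] at h0
  simp only [card_empty, Nat.cast_zero, zero_div, abs_nonpos_iff] at h0
  rw [h0] at hst
  simp [hv, hv', he] at hst

/-- A stability assignment all of whose members are stable for `φ` is the assignment of `φ`. -/
theorem nondegenerate_and_eq_stabAssign {ends : E → V × V} (hconn : Conn ends univ) {d : ℤ}
    {σ : Finset E → Set (V → ℤ)} (hσ : IsStabilityAssignment ends d σ) {φ : V → ℝ}
    (H : ∀ A, ∀ x ∈ σ A, PhiStable ends φ A x) :
    Nondegenerate ends d φ ∧ σ = stabAssign ends d φ := by
  have key : ∀ A : Finset E, Conn ends A → ∀ x ∈ Sdeg d A, PhiSemistable ends φ A x → x ∈ σ A := by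
    intro A hA x hx hss
    obtain ⟨y, ⟨hy, hxy⟩, -⟩ := (hσ.2.2 A hA).2 x hx
    rwa [eq_of_semistable_of_stable hss (H A y hy) hxy]
  refine ⟨nondegenerate_of_conn hconn fun A hA x hx hss => H A x (key A hA x hx hss), ?_⟩
  ext A x
  exact ⟨fun hx => ⟨(hσ.1 A x hx).1, (hσ.1 A x hx).2, fun W h h' => (H A x hx W h h').le⟩,
    fun ⟨hA, hx, hss⟩ => key A hA x hx hss⟩

/-! ### Unicyclic multigraphs -/

theorem conn_erase_of_cycle {ends : E → V × V} (hconn : Conn ends univ) {h : E → ℤ}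
    (hh : bdry ends h = 0) {e : E} (he : h e ≠ 0) : Conn ends (univ.erase e) := by
  by_contra hA
  have := hconn.1
  obtain ⟨W, hW, hW', hcut⟩ := exists_cut_of_not_conn ends hA
  have honly : ∀ e' ∈ cutE ends W, e' = e := fun e' he' => by
    by_contra hne
    have := mem_inter.2 ⟨mem_erase.2 ⟨hne, mem_univ e'⟩, he'⟩
    simp [hcut] at this
  have hmem : e ∈ cutE ends W := by
    obtain ⟨e', he'⟩ := cutE_inter_nonempty ends hconn hW hW'
    rw [univ_inter] at he'
    rwa [honly e' he'] at he'
  have hsum := sum_bdry ends W h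
  rw [hh, Fintype.sum_eq_single e] at hsum
  · have := abs_cutSign ends W e
    simp only [Pi.zero_apply, sum_const_zero] at hsum
    have h0 : cutSign ends W e = 0 := by
      rcases mul_eq_zero.1 hsum.symm with h0 | h0
      · exact absurd h0 he
      · exact h0
    rw [h0, if_pos hmem] at this
    simp at this
  · intro e' hne
    have := abs_cutSign ends W e'
    rw [if_neg fun hm => hne (honly e' hm), abs_eq_zero] at this
    rw [this, mul_zero]

theorem exists_cycle_of_conn {ends : E → V × V} {A : Finset E} (hA : Conn ends A) {e : E}
    (he : e ∉ A) :
    ∃ g : E → ℤ, bdry ends g = 0 ∧ g e = 1 ∧ ∀ e' ∉ insert e A, g e' = 0 := by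
  obtain ⟨f, hf, hb⟩ := exists_flow_of_linked ends A (hA.2 (ends e).2 (ends e).1)
  refine ⟨f + Pi.single e 1, ?_, ?_, fun e' he' => ?_⟩
  · rw [map_add, hb, bdry_single]
    simp
  · simp [hf e he]
  · rw [mem_insert, not_or] at he'
    simp [hf e' he'.2, he'.1]

/-- `h` generates the group of integral cycles. -/
def IsCycleGenerator (ends : E → V × V) (h : E → ℤ) : Prop :=
  bdry ends h = 0 ∧ ∀ g, bdry ends g = 0 → ∃ m : ℤ, g = m • h

theorem IsCycleGenerator.eq_erase_of_conn {ends : E → V × V} {h : E → ℤ}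
    (hh : IsCycleGenerator ends h) {A : Finset E} (hA : Conn ends A) {e : E} (he : e ∉ A) :
    A = univ.erase e ∧ (h e = 1 ∨ h e = -1) := by
  have key : ∀ e ∉ A, ∃ m : ℤ, m * h e = 1 ∧ ∀ e' ∉ insert e A, m * h e' = 0 := by
    intro e he
    obtain ⟨g, hg, h1, h0⟩ := exists_cycle_of_conn hA he
    obtain ⟨m, rfl⟩ := hh.2 g hg
    exact ⟨m, h1, h0⟩
  obtain ⟨m, hm, hm0⟩ := key e he
  refine ⟨?_, Int.isUnit_iff.1 (IsUnit.of_mul_eq_one_right m hm)⟩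
  ext e'
  simp only [mem_erase, mem_univ, and_true]
  refine ⟨fun h1 h2 => he (h2 ▸ h1), fun hne => ?_⟩
  by_contra he'
  obtain ⟨m', hm', -⟩ := key e' he'
  have hz := hm0 e' (by simp [hne, he'])
  rcases mul_eq_zero.1 hz with h0 | h0
  · simp [h0] at hm
  · simp [h0] at hm'

theorem IsCycleGenerator.eq_one_or_neg_one {ends : E → V × V} (hconn : Conn ends univ) {h : E → ℤ}
    (hh : IsCycleGenerator ends h) {e : E} (he : h e ≠ 0) : h e = 1 ∨ h e = -1 :=
  (hh.eq_erase_of_conn (conn_erase_of_cycle hconn hh.1 he) (notMem_erase e univ)).2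

/-- Flows orthogonal to all cycles are coboundaries. -/
theorem IsCycleGenerator.exists_eq_cobdryOn {ends : E → V × V} (hconn : Conn ends univ)
    {h : E → ℤ} (hh : IsCycleGenerator ends h) {f : E → ℤ} (hf : ∑ e, h e * f e = 0) :
    ∃ u : V → ℤ, f = cobdryOn ends univ u := by
  obtain ⟨⟨r⟩, hl⟩ := hconn
  choose p _ hp using fun v => exists_flow_of_linked ends univ (hl r v)
  refine ⟨fun v => ∑ e, p v e * f e, ?_⟩
  ext e
  rw [cobdryOn_apply, if_pos (mem_univ e)]
  obtain ⟨m, hm⟩ := hh.2 (p (ends e).1 + Pi.single e 1 - p (ends e).2) (by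
    rw [map_sub, map_add, hp, hp, bdry_single, one_smul]
    abel)
  have h1 : ∑ e', (p (ends e).1 + Pi.single e 1 - p (ends e).2 : E → ℤ) e' * f e' = 0 := by
    rw [hm]
    simp only [Pi.smul_apply, smul_eq_mul, mul_assoc]
    rw [← mul_sum, hf, mul_zero]
  simp only [Pi.sub_apply, Pi.add_apply, sub_mul, add_mul, sum_sub_distrib, sum_add_distrib,
    Pi.single_apply, ite_mul, one_mul, zero_mul, sum_ite_eq', mem_univ, if_true] at h1
  linarith

theorem IsCycleGenerator.mem_twGroup {ends : E → V × V} (hconn : Conn ends univ)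
    {h : E → ℤ} (hh : IsCycleGenerator ends h) {f : E → ℤ}
    (hf : (∑ e, h e * h e) ∣ ∑ e, h e * f e) : bdry ends f ∈ twGroup ends univ := by
  obtain ⟨m, hm⟩ := hf
  obtain ⟨u, hu⟩ := hh.exists_eq_cobdryOn hconn (f := f - m • h) (by
    simp only [Pi.sub_apply, Pi.smul_apply, smul_eq_mul, mul_sub, sum_sub_distrib, hm]
    rw [sub_eq_zero, sum_mul]
    exact sum_congr rfl fun e _ => by ring)
  refine (mem_twGroup_iff _ _ _).2 ⟨u, ?_⟩
  rw [← hu, map_sub, map_smul, hh.1, smul_zero, sub_zero]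

theorem IsCycleGenerator.sum_mul_self {ends : E → V × V} (hconn : Conn ends univ) {h : E → ℤ}
    (hh : IsCycleGenerator ends h) : ∑ e, h e * h e = ((univ.filter fun e => h e ≠ 0).card : ℤ) := by
  rw [card_filter, Nat.cast_sum]
  refine sum_congr rfl fun e _ => ?_
  by_cases he : h e = 0
  · simp [he]
  · rcases hh.eq_one_or_neg_one hconn he with h1 | h1 <;> simp [h1]

theorem exists_oriented_ends (ends : E → V × V) {e : E} {c : ℤ} (hc : c = 1 ∨ c = -1) :
    ∃ p : V × V, eSym ends e = s(p.1, p.2) ∧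
      c • (stdVec (ends e).2 - stdVec (ends e).1) = stdVec p.2 - stdVec p.1 := by
  rcases hc with rfl | rfl
  · exact ⟨ends e, rfl, one_smul _ _⟩
  · exact ⟨(ends e).swap, Sym2.eq_swap, by simp⟩

/-! ### Cyclic sequences -/

theorem two_mul_abs_sub_le {k : ℕ} [NeZero k] (S : ZMod k → ℤ) (i j : ZMod k) :
    2 * |S i - S j| ≤ ∑ l, |S (l + 1) - S l| := by
  have hF : ∀ F : ZMod k → ℤ, ∑ l ∈ range k, F (j + (l : ZMod k)) = ∑ l, F l := by
    intro F
    rw [← Equiv.sum_comp (Equiv.addLeft j) F]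
    obtain _ | n := k
    · exact absurd rfl (NeZero.ne 0)
    rw [← Fin.sum_univ_eq_sum_range (fun l : ℕ => F (j + (l : ZMod (n + 1))))]
    refine Fintype.sum_congr _ _ fun l => ?_
    congr 2
    exact Fin.cast_val_eq_self l
  obtain ⟨m, hm, hij⟩ : ∃ m ≤ k, i = j + (m : ZMod k) :=
    ⟨(i - j).val, (ZMod.val_lt _).le, by simp⟩
  have htel : ∀ n : ℕ, ∑ l ∈ range n, (S (j + (l : ZMod k) + 1) - S (j + (l : ZMod k))) =
      S (j + (n : ZMod k)) - S j := fun n => by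
    simpa [add_assoc] using sum_range_sub (fun l : ℕ => S (j + (l : ZMod k))) n
  have hk := htel k
  rw [ZMod.natCast_self, add_zero, sub_self, ← sum_range_add_sum_Ico _ hm, htel m, ← hij] at hk
  rw [← hF, ← sum_range_add_sum_Ico _ hm, two_mul]
  refine add_le_add ?_ ?_
  · rw [hij, ← htel m]
    exact abs_sum_le_sum_abs _ _
  · rw [eq_neg_of_add_eq_zero_left hk, abs_neg]
    exact abs_sum_le_sum_abs _ _

theorem abs_sub_average_lt {ι : Type*} [Fintype ι] [Nonempty ι] (S : ι → ℝ) (z b : ℝ)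
    (hb : ∀ i, |z - S i| ≤ b) (h₁ : ∃ i, z - S i < b) (h₂ : ∃ i, S i - z < b) :
    |z - (∑ i, S i) / Fintype.card ι| < b := by
  have hpos : (0 : ℝ) < Fintype.card ι := by exact_mod_cast Fintype.card_pos
  have key : ∀ T : ι → ℝ, (∀ i, T i ≤ b) → (∃ i, T i < b) → ∑ i, T i < Fintype.card ι * b := by
    intro T hT hT'
    have := sum_lt_sum (s := univ) (fun i _ => hT i) (by simpa using hT')
    simpa using this
  have k₁ := key _ (fun i => (le_abs_self _).trans (hb i)) h₁
  have k₂ := key (fun i => S i - z) (fun i => by linarith [neg_abs_le (z - S i), hb i]) h₂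
  simp only [sum_sub_distrib, sum_const, card_univ, nsmul_eq_mul] at k₁ k₂
  have : z - (∑ i, S i) / Fintype.card ι = (Fintype.card ι * z - ∑ i, S i) / Fintype.card ι := by
    field_simp
  rw [this, abs_lt, lt_div_iff₀ hpos, div_lt_iff₀ hpos]
  constructor <;> linarith

/-! ### The average polarization -/

section Average

variable {ι : Type*} [Fintype ι] [Nonempty ι]

/-- The average of a finite family of multidegrees. -/
noncomputable def average (Y : ι → V → ℤ) (v : V) : ℝ := (∑ i, (Y i v : ℝ)) / Fintype.card ι

theorem sum_average (Y : ι → V → ℤ) (W : Finset V) :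
    ∑ v ∈ W, average Y v = (∑ i, ((∑ v ∈ W, Y i v : ℤ) : ℝ)) / Fintype.card ι := by
  simp only [average, ← sum_div]
  rw [sum_comm]
  push_cast
  rfl

variable {ends : E → V × V} {Y : ι → V → ℤ}

theorem two_mul_abs_sub_le_cast
    (hY : ∀ W i j, 2 * |∑ v ∈ W, Y i v - ∑ v ∈ W, Y j v| ≤ ((cutE ends W).card : ℤ))
    (W : Finset V) (i j : ι) :
    2 * |((∑ v ∈ W, Y i v : ℤ) : ℝ) - ((∑ v ∈ W, Y j v : ℤ) : ℝ)| ≤ ((cutE ends W).card : ℝ) := by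
  exact_mod_cast hY W i j

theorem abs_sum_sub_average_lt
    (hY : ∀ W i j, 2 * |∑ v ∈ W, Y i v - ∑ v ∈ W, Y j v| ≤ ((cutE ends W).card : ℤ))
    {W : Finset V} (hW : 0 < (cutE ends W).card) (j : ι) :
    |((∑ v ∈ W, Y j v : ℤ) : ℝ) - ∑ v ∈ W, average Y v| < ((cutE ends W).card : ℝ) / 2 := by
  have hpos : (0 : ℝ) < (cutE ends W).card := by exact_mod_cast hW
  rw [sum_average]
  refine abs_sub_average_lt _ _ _ (fun i => ?_) ⟨j, by linarith⟩ ⟨j, by linarith⟩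
  linarith [two_mul_abs_sub_le_cast hY W j i]

theorem abs_midpoint_sub_average_lt
    (hY : ∀ W i j, 2 * |∑ v ∈ W, Y i v - ∑ v ∈ W, Y j v| ≤ ((cutE ends W).card : ℤ))
    {W : Finset V} (hW : 0 < (cutE ends W).card) {i j : ι}
    (hij : ∑ v ∈ W, Y j v = ∑ v ∈ W, Y i v + 1) :
    |((∑ v ∈ W, Y i v : ℤ) : ℝ) + 1 / 2 - ∑ v ∈ W, average Y v| <
      (((cutE ends W).card : ℝ) - 1) / 2 := by
  have hpos : (1 : ℝ) ≤ (cutE ends W).card := by exact_mod_cast hW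
  have hij' : ((∑ v ∈ W, Y j v : ℤ) : ℝ) = ((∑ v ∈ W, Y i v : ℤ) : ℝ) + 1 := by
    exact_mod_cast hij
  rw [sum_average]
  refine abs_sub_average_lt _ _ _ (fun l => ?_) ⟨j, by linarith⟩ ⟨i, by linarith⟩
  have h1 := two_mul_abs_sub_le_cast hY W i l
  have h2 := two_mul_abs_sub_le_cast hY W j l
  have h3 := neg_abs_le (((∑ v ∈ W, Y i v : ℤ) : ℝ) - ((∑ v ∈ W, Y l v : ℤ) : ℝ))
  have h4 := le_abs_self (((∑ v ∈ W, Y j v : ℤ) : ℝ) - ((∑ v ∈ W, Y l v : ℤ) : ℝ))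
  rw [abs_le]
  constructor <;> linarith

theorem phiStable_average_univ
    (hY : ∀ W i j, 2 * |∑ v ∈ W, Y i v - ∑ v ∈ W, Y j v| ≤ ((cutE ends W).card : ℤ))
    (hconn : Conn ends univ) (j : ι) :
    PhiStable ends (average Y) univ (Y j) := by
  intro W hW hW'
  have hcut := card_pos.2 (cutE_inter_nonempty ends hconn hW hW')
  rw [univ_inter] at hcut ⊢
  have := abs_sum_sub_average_lt hY hcut j
  push_cast at this
  simpa [sum_sub_distrib] using this

theorem phiStable_average_erase
    (hY : ∀ W i j, 2 * |∑ v ∈ W, Y i v - ∑ v ∈ W, Y j v| ≤ ((cutE ends W).card : ℤ))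
    {e : E} (hconn : Conn ends (univ.erase e)) {x : V → ℤ} {v v' : V}
    (hs : eSym ends e = s(v, v')) {i j : ι} (hi : x + stdVec v = Y i) (hj : x + stdVec v' = Y j) :
    PhiStable ends (average Y) (univ.erase e) x := by
  intro W hW hW'
  have hcut := card_pos.2 (cutE_inter_nonempty ends hconn hW hW')
  have he : e ∉ univ.erase e := notMem_erase e univ
  have hcard := card_insert_inter he (cutE ends W)
  have hd := defect_insert ends (average Y) x W he hs
  have hc := ite_mem_cutE ends hs W
  rw [← defect]
  rw [insert_erase (mem_univ e), univ_inter] at hcard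
  rw [insert_erase (mem_univ e), hi, defect] at hd
  simp only [sdiff_self, bot_eq_empty, empty_inter, card_empty, Nat.cast_zero, zero_div, add_zero,
    sum_sub_distrib] at hd
  have hpos : 0 < (cutE ends W).card := by omega
  have hcard' : (((univ.erase e ∩ cutE ends W).card : ℕ) : ℝ) =
      (cutE ends W).card - if e ∈ cutE ends W then 1 else 0 := by
    rw [hcard]
    push_cast
    ring
  have hSi : ∑ w ∈ W, Y i w = ∑ w ∈ W, x w + if v ∈ W then 1 else 0 := by
    rw [← hi, ← sum_stdVec, ← sum_add_distrib]
    rfl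
  have hSj : ∑ w ∈ W, Y j w = ∑ w ∈ W, x w + if v' ∈ W then 1 else 0 := by
    rw [← hj, ← sum_stdVec, ← sum_add_distrib]
    rfl
  rw [hcard', hc]
  by_cases hv : v ∈ W <;> by_cases hv' : v' ∈ W <;>
    simp only [hv, hv', if_true, if_false] at hd hSi hSj ⊢
  · have := abs_sum_sub_average_lt hY hpos i
    push_cast at this
    rw [hd] at this
    simpa using this
  · have := abs_midpoint_sub_average_lt hY hpos (i := j) (j := i) (by omega)
    have hji : ((∑ w ∈ W, Y i w : ℤ) : ℝ) = ((∑ w ∈ W, Y j w : ℤ) : ℝ) + 1 := by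
      exact_mod_cast (by omega : ∑ w ∈ W, Y i w = ∑ w ∈ W, Y j w + 1)
    push_cast at this hji
    rw [hji] at hd
    norm_num
    convert this using 2
    linarith
  · have := abs_midpoint_sub_average_lt hY hpos (i := i) (j := j) (by omega)
    push_cast at this
    norm_num
    convert this using 2
    linarith
  · have := abs_sum_sub_average_lt hY hpos i
    push_cast at this
    rw [hd] at this
    simpa using this

end Average

/-- Every multidegree on a nonempty vertex set has a representative in a representative set. -/
theorem IsRepSet.nonempty {ends : E → V × V} [Nonempty V] {d : ℤ} {A : Finset E}
    {S : Set (V → ℤ)} (hS : IsRepSet ends d A S) : S.Nonempty := by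
  obtain ⟨r⟩ := ‹Nonempty V›
  obtain ⟨y, ⟨hy, -⟩, -⟩ := hS.2 ((d - (nG A : ℤ)) • stdVec r) (by
    simp [Sdeg, ← mul_sum, sum_stdVec])
  exact ⟨y, hy⟩

/-- The members of a stability assignment on a unicyclic multigraph can be arranged cyclically, so
that two consecutive members differ by moving one chip along an edge of the cycle. -/
theorem exists_cyclic_enumeration {ends : E → V × V} (hconn : Conn ends univ)
    (hb1 : Fintype.card E = Fintype.card V) {d : ℤ} {σ : Finset E → Set (V → ℤ)}
    (hσ : IsStabilityAssignment ends d σ) :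
    ∃ (k : ℕ) (_ : NeZero k) (Y : ZMod k → V → ℤ), (∀ z, z ∈ σ univ ↔ ∃ j, Y j = z) ∧
      ∀ W i j, 2 * |∑ v ∈ W, Y i v - ∑ v ∈ W, Y j v| ≤ ((cutE ends W).card : ℤ) := by
  obtain ⟨h, hh0, hne, hgen⟩ := exists_cycle_generator ends hconn hb1
  have hh : IsCycleGenerator ends h := ⟨hh0, hgen⟩
  have := hconn.1
  obtain ⟨e₀, he₀⟩ := Function.ne_iff.1 hne
  let C := {e : E // h e ≠ 0}
  let k := Fintype.card C
  have : Nonempty C := ⟨⟨e₀, he₀⟩⟩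
  have hk0 : NeZero k := ⟨Fintype.card_ne_zero⟩
  have hkk : ∑ e, h e * h e = (k : ℤ) := by
    rw [hh.sum_mul_self hconn, ← Fintype.card_subtype]
  have hrep := hσ.2.2 univ hconn
  have hdeg : ∀ z ∈ σ univ, ∑ v, z v = d := fun z hz => by
    simpa [Sdeg, nG] using hrep.1 hz
  choose x hx using fun e : C =>
    (hσ.2.2 _ (conn_erase_of_cycle hconn hh0 e.2)).nonempty
  choose p hps hpb using fun e : C => exists_oriented_ends ends (e := e.1)
    (hh.eq_one_or_neg_one hconn e.2)
  have hadd : ∀ (e : C) (v : V), v ∈ eSym ends e → x e + stdVec v ∈ σ univ := fun e v hv => by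
    simpa [insert_erase] using hσ.2.1 _ _ (hx e) e (notMem_erase _ _) v hv
  have hy : ∀ e : C, x e + stdVec (p e).1 ∈ σ univ := fun e => hadd e _ (by simp [hps])
  have hy' : ∀ e : C, x e + stdVec (p e).2 ∈ σ univ := fun e => hadd e _ (by simp [hps])
  obtain ⟨D, hD⟩ := hrep.nonempty
  have hflow : ∀ z : V → ℤ, ∃ f : E → ℤ, z ∈ σ univ → bdry ends f = z - D := fun z => by
    by_cases hz : z ∈ σ univ
    · obtain ⟨f, hf⟩ := exists_bdry_eq ends hconn (z - D) (by simp [hdeg z hz, hdeg D hD])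
      exact ⟨f, fun _ => hf⟩
    · exact ⟨0, fun h => absurd h hz⟩
  choose F hF using hflow
  let c : (V → ℤ) → ZMod k := fun z => ((∑ e, h e * F z e : ℤ) : ZMod k)
  have hc : ∀ z ∈ σ univ, ∀ z' ∈ σ univ, ∀ f, bdry ends f = z - z' →
      c z = c z' + ((∑ e, h e * f e : ℤ) : ZMod k) := by
    intro z hz z' hz' f hf
    obtain ⟨m, hm⟩ := hgen (F z - F z' - f) (by
      rw [map_sub, map_sub, hF z hz, hF z' hz', hf]
      abel)
    have h1 : ∑ e, h e * (F z - F z' - f) e = k * m := by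
      rw [hm, ← hkk, sum_mul]
      exact sum_congr rfl fun e _ => by simp only [Pi.smul_apply, smul_eq_mul]; ring
    simp only [Pi.sub_apply, mul_sub, sum_sub_distrib] at h1
    have h2 := congrArg (Int.cast : ℤ → ZMod k) h1
    rw [Int.cast_sub, Int.cast_sub, Int.cast_mul, Int.cast_natCast, ZMod.natCast_self,
      zero_mul, sub_sub, sub_eq_zero] at h2
    exact h2
  have hcinj : ∀ z ∈ σ univ, ∀ z' ∈ σ univ, c z = c z' → z = z' := by
    intro z hz z' hz' hzz
    obtain ⟨f, hf⟩ := exists_bdry_eq ends hconn (z - z') (by simp [hdeg z hz, hdeg z' hz'])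
    have h1 := hc z hz z' hz' f hf
    rw [hzz, left_eq_add, ZMod.intCast_zmod_eq_zero_iff_dvd, ← hkk] at h1
    have h2 := hh.mem_twGroup hconn h1
    rw [hf] at h2
    exact (hrep.2 z (hrep.1 hz)).unique ⟨hz, by simp [zero_mem]⟩ ⟨hz', h2⟩
  have hstep : ∀ e : C, c (x e + stdVec (p e).2) = c (x e + stdVec (p e).1) + 1 := by
    intro e
    rw [hc _ (hy' e) _ (hy e) (Pi.single e.1 (h e)) (by rw [bdry_single, hpb]; abel)]
    congr 1
    rw [Fintype.sum_eq_single e.1 (fun e' he' => by simp [he']), Pi.single_eq_same]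
    rcases hh.eq_one_or_neg_one hconn e.2 with h1 | h1 <;> simp [h1]
  have hbij : Function.Bijective fun e : C => c (x e + stdVec (p e).1) := by
    refine (Fintype.bijective_iff_injective_and_card _).2 ⟨?_, (ZMod.card k).symm⟩
    intro e e' (hee : c (x e + stdVec (p e).1) = c (x e' + stdVec (p e').1))
    have h1 := hcinj _ (hy e) _ (hy e') hee
    have h2 := hcinj _ (hy' e) _ (hy' e') (by rw [hstep, hstep, hee])
    by_contra hee'
    have hne : e.1 ≠ e'.1 := fun h => hee' (Subtype.ext h)
    obtain ⟨m, hm⟩ := hgen (Pi.single e.1 (h e) - Pi.single e'.1 (h e')) (by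
      rw [map_sub, bdry_single, bdry_single, hpb, hpb, sub_eq_zero,
        ← add_sub_add_left_eq_sub _ _ (x e), h1, h2, add_sub_add_left_eq_sub])
    have h3 := congrFun hm e.1
    have h4 := congrFun hm e'.1
    simp only [Pi.sub_apply, Pi.smul_apply, smul_eq_mul, Pi.single_eq_same,
      Pi.single_eq_of_ne hne, Pi.single_eq_of_ne hne.symm] at h3 h4
    have h5 : m = 1 := mul_right_cancel₀ e.2 (by linarith)
    have h6 := e'.2
    rw [h5] at h4
    omega
  let ε := Equiv.ofBijective _ hbij
  have hε : ∀ j, c (x (ε.symm j) + stdVec (p (ε.symm j)).1) = j := fun j => ε.apply_symm_apply j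
  refine ⟨k, hk0, fun j => x (ε.symm j) + stdVec (p (ε.symm j)).1, fun z => ⟨fun hz =>
    ⟨c z, hcinj _ (hy _) _ hz (hε _)⟩, fun ⟨j, hj⟩ => hj ▸ hy _⟩, fun W i j => ?_⟩
  refine (two_mul_abs_sub_le (fun j => ∑ v ∈ W, (x (ε.symm j) + stdVec (p (ε.symm j)).1) v)
    i j).trans ?_
  have hnext : ∀ j, x (ε.symm (j + 1)) + stdVec (p (ε.symm (j + 1))).1 =
      x (ε.symm j) + stdVec (p (ε.symm j)).2 := fun j =>
    hcinj _ (hy _) _ (hy' _) (by rw [hε, hstep, hε])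
  have hterm : ∀ e : C, |∑ v ∈ W, (x e + stdVec (p e).2) v - ∑ v ∈ W, (x e + stdVec (p e).1) v| =
      |cutSign ends W e| := by
    intro e
    rw [← sum_sub_distrib]
    have h1 : ∑ v ∈ W, bdry ends (Pi.single e.1 (h e)) v = h e * cutSign ends W e := by
      rw [sum_bdry, Fintype.sum_eq_single e.1 (fun e' he' => by simp [he']), Pi.single_eq_same]
    rw [bdry_single, hpb] at h1
    simp only [Pi.add_apply, add_sub_add_left_eq_sub]
    have h2 : |h e * cutSign ends W e| = |cutSign ends W e| := by
      rcases hh.eq_one_or_neg_one hconn e.2 with h2 | h2 <;> simp [h2]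
    rw [← h2, ← h1]
    rfl
  simp only [hnext, hterm]
  rw [Equiv.sum_comp ε.symm (fun e : C => |cutSign ends W e|), ← sum_abs_cutSign]
  rw [← sum_subtype (univ.filter fun e => h e ≠ 0) (by simp) fun e => |cutSign ends W e|]
  exact sum_le_sum_of_subset_of_nonneg (subset_univ _) fun _ _ _ => abs_nonneg _

/-- If `Γ` is a finite connected multigraph with first Betti number
`b₁(Γ) = |E| − |V| + 1 = 1`, then every degree-`d` stability assignment `σ` for `Γ` is of
the form `stab_{Γ,φ}` for some nondegenerate numerical polarization `φ ∈ V^d(Γ)`. -/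
theorem statement17 (ends : E → V × V)
    (hconn : Conn ends (Finset.univ : Finset E))
    (hb1 : Fintype.card E = Fintype.card V)
    (d : ℤ) (σ : Finset E → Set (V → ℤ)) (hσ : IsStabilityAssignment ends d σ) :
    ∃ φ : V → ℝ, (∑ v : V, φ v = (d : ℝ)) ∧ Nondegenerate ends d φ ∧
      σ = stabAssign ends d φ := by
  obtain ⟨k, _, Y, hYσ, hY⟩ := exists_cyclic_enumeration hconn hb1 hσ
  obtain ⟨h, hh0, -, hgen⟩ := exists_cycle_generator ends hconn hb1
  refine ⟨average Y, ?_, nondegenerate_and_eq_stabAssign hconn hσ fun A x hx => ?_⟩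
  · have hdeg : ∀ j, ∑ v, Y j v = d := fun j => by
      simpa [Sdeg, nG] using (hσ.1 univ (Y j) ((hYσ _).2 ⟨j, rfl⟩)).2
    rw [sum_average]
    simp [hdeg, NeZero.ne k]
  by_cases hA : A = univ
  · subst hA
    obtain ⟨j, rfl⟩ := (hYσ x).1 hx
    exact phiStable_average_univ hY hconn j
  · obtain ⟨e, he⟩ : ∃ e, e ∉ A := by
      by_contra! hall
      exact hA (eq_univ_iff_forall.2 hall)
    have hAconn := (hσ.1 A x hx).1
    obtain ⟨rfl, -⟩ := IsCycleGenerator.eq_erase_of_conn ⟨hh0, hgen⟩ hAconn he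
    have hadd : ∀ v ∈ eSym ends e, ∃ j, Y j = x + stdVec v := fun v hv => (hYσ _).1 (by
      simpa [insert_erase] using hσ.2.1 _ x hx e he v hv)
    obtain ⟨i, hi⟩ := hadd (ends e).1 (by simp [eSym])
    obtain ⟨j, hj⟩ := hadd (ends e).2 (by simp [eSym])
    exact phiStable_average_erase hY hAconn rfl hi.symm hj.symm
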